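/- Let (X,d) be a complete cone metric space over a Banach algebra A with solid cone P, and let T_n, T : X → X (n ∈ ℕ) satisfy: (i) each T_n is an α-contraction w.r.t. d for a common α ∈ P with ρ(α) < 1; (ii) T is an α₀-contraction w.r.t. d for some α₀ ∈ P with ρ(α₀) < 1; (iii) T_n converges pointwise to T w.r.t. d. Then each T_n has a unique fixed point x_n*, T has a unique fixed point x*, and the sequence (d(x_n*, x*))_{n∈ℕ} is a c-sequence. -/

import Mathlib

open Filter Topology

/-- Spectral radius via the Gelfand formula: `inf_{n ≥ 1} ‖k ^ n‖ ^ (1 / n)`. -/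
noncomputable def specRad {A : Type*} [NormedRing A] (k : A) : ℝ :=
  ⨅ n : ℕ, ‖k ^ (n + 1)‖ ^ ((1 : ℝ) / (n + 1))

/-- A cone in a real Banach algebra `A`: a nonempty closed subset containing `0` and `1`,
closed under nonnegative real combinations and multiplication, with `P ∩ (-P) = {0}`. -/
structure IsCone {A : Type*} [NormedRing A] [NormedAlgebra ℝ A] (P : Set A) : Prop where
  closed : IsClosed P
  zero_mem : (0 : A) ∈ P
  one_mem : (1 : A) ∈ P
  smul_mem : ∀ a : ℝ, 0 ≤ a → ∀ x ∈ P, a • x ∈ P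
  add_mem : ∀ x ∈ P, ∀ y ∈ P, x + y ∈ P
  mul_mem : ∀ x ∈ P, ∀ y ∈ P, x * y ∈ P
  antisymm : ∀ x ∈ P, -x ∈ P → x = 0

/-- A c-sequence with respect to the solid cone `P`: for every `c ≫ 0` eventually `u n ≪ c`. -/
def CSeq {A : Type*} [NormedRing A] [NormedAlgebra ℝ A] (P : Set A) (u : ℕ → A) : Prop :=
  ∀ c : A, c ∈ interior P → ∃ N : ℕ, ∀ n ≥ N, c - u n ∈ interior P

/-- A cone metric on `X` over the Banach algebra `A` with cone `P`. -/
structure IsConeMetric {A : Type*} [NormedRing A] [NormedAlgebra ℝ A] (P : Set A)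
    {X : Type*} (d : X → X → A) : Prop where
  mem_cone : ∀ x y, d x y ∈ P
  eq_zero_iff : ∀ x y, d x y = 0 ↔ x = y
  symm : ∀ x y, d x y = d y x
  triangle : ∀ x y z, d x y + d y z - d x z ∈ P

/-- Completeness of a cone metric space over a Banach algebra:
every Cauchy sequence converges (in the c-sequence sense). -/
def ConeComplete {A : Type*} [NormedRing A] [NormedAlgebra ℝ A] (P : Set A)
    {X : Type*} (d : X → X → A) : Prop :=
  ∀ u : ℕ → X,
    (∀ c : A, c ∈ interior P → ∃ N : ℕ, ∀ m ≥ N, ∀ n ≥ N, c - d (u m) (u n) ∈ interior P) →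
    ∃ x : X, CSeq P fun n => d (u n) x

/-- `Tinf` is a (G)-limit of the family `T` (property (G)). -/
def GLimit {A : Type*} [NormedRing A] [NormedAlgebra ℝ A] (P : Set A)
    {X : Type*} (d : X → X → A) (Xn : ℕ → Set X) (Xinf : Set X)
    (T : ℕ → X → X) (Tinf : X → X) : Prop :=
  ∀ x ∈ Xinf, ∃ u : ℕ → X, (∀ n, u n ∈ Xn n) ∧
    CSeq P (fun n => d (u n) x) ∧ CSeq P (fun n => d (T n (u n)) (Tinf x))

/-- `Tinf` is an (H)-limit of the family `T` (property (H)). -/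
def HLimit {A : Type*} [NormedRing A] [NormedAlgebra ℝ A] (P : Set A)
    {X : Type*} (d : X → X → A) (Xn : ℕ → Set X) (Xinf : Set X)
    (T : ℕ → X → X) (Tinf : X → X) : Prop :=
  ∀ u : ℕ → X, (∀ n, u n ∈ Xn n) → ∃ v : ℕ → X, (∀ n, v n ∈ Xinf) ∧
    CSeq P (fun n => d (u n) (v n)) ∧ CSeq P (fun n => d (T n (u n)) (Tinf (v n)))

section Algebra

variable {A : Type*} [NormedRing A]

theorem exists_norm_pow_lt_one_of_specRad_lt_one {k : A} (h : specRad k < 1) :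
    ∃ m : ℕ, 0 < m ∧ ‖k ^ m‖ < 1 := by
  obtain ⟨n, hn⟩ := exists_lt_of_ciInf_lt h
  refine ⟨n + 1, n.succ_pos, ?_⟩
  by_contra! hle
  exact hn.not_ge (Real.one_le_rpow hle (by positivity))

theorem tendsto_pow_zero_of_specRad_lt_one {k : A} (h : specRad k < 1) :
    Tendsto (fun n : ℕ => k ^ n) atTop (𝓝 0) := by
  obtain ⟨m, hm, hlt⟩ := exists_norm_pow_lt_one_of_specRad_lt_one h
  have hpow : Tendsto (fun n : ℕ => ‖(k ^ m) ^ (n / m)‖ * ∑ r ∈ Finset.range m, ‖k ^ r‖)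
      atTop (𝓝 0) := by
    have h0 := ((tendsto_pow_atTop_nhds_zero_of_norm_lt_one hlt).comp
      (Nat.tendsto_div_const_atTop hm.ne')).norm.mul_const (∑ r ∈ Finset.range m, ‖k ^ r‖)
    simpa using h0
  refine squeeze_zero_norm (fun n => ?_) hpow
  calc ‖k ^ n‖ = ‖(k ^ m) ^ (n / m) * k ^ (n % m)‖ := by
        rw [← pow_mul, ← pow_add, Nat.div_add_mod]
    _ ≤ ‖(k ^ m) ^ (n / m)‖ * ‖k ^ (n % m)‖ := norm_mul_le _ _
    _ ≤ _ := by
        gcongr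
        exact Finset.single_le_sum (f := fun r => ‖k ^ r‖) (fun _ _ => norm_nonneg _)
          (Finset.mem_range.2 (Nat.mod_lt _ hm))

end Algebra

section Cone

variable {A : Type*} [NormedRing A] [NormedAlgebra ℝ A] {P : Set A}

theorem IsCone.pow_mem (hP : IsCone P) {a : A} (ha : a ∈ P) (n : ℕ) : a ^ n ∈ P := by
  induction n with
  | zero => simpa using hP.one_mem
  | succ n ih => rw [pow_succ]; exact hP.mul_mem _ ih _ ha

theorem IsCone.sum_mem (hP : IsCone P) {f : ℕ → A} (hf : ∀ i, f i ∈ P) (s : Finset ℕ) :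
    ∑ i ∈ s, f i ∈ P :=
  Finset.sum_induction f (· ∈ P) (fun a b ha hb => hP.add_mem a ha b hb) hP.zero_mem
    fun i _ => hf i

/-- An element of the cone with spectral radius less than one has a resolvent at `1` which lies
in the cone. -/
theorem IsCone.exists_inverse_one_sub [CompleteSpace A] (hP : IsCone P) {k : A} (hk : k ∈ P)
    (h : specRad k < 1) : ∃ r ∈ P, r * (1 - k) = 1 ∧ (1 - k) * r = 1 := by
  obtain ⟨m, -, hlt⟩ := exists_norm_pow_lt_one_of_specRad_lt_one h
  have hsum := summable_geometric_of_norm_lt_one hlt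
  have hS : ∑' i : ℕ, (k ^ m) ^ i ∈ P :=
    hP.closed.mem_of_tendsto hsum.hasSum
      (Eventually.of_forall fun s => hP.sum_mem (fun i => hP.pow_mem (hP.pow_mem hk m) i) s)
  have hG : ∑ i ∈ Finset.range m, k ^ i ∈ P := hP.sum_mem (fun i => hP.pow_mem hk i) _
  have hleft : ((∑' i : ℕ, (k ^ m) ^ i) * ∑ i ∈ Finset.range m, k ^ i) * (1 - k) = 1 := by
    rw [mul_assoc, geom_sum_mul_neg]
    exact geom_series_mul_neg _ hlt
  have hright : (1 - k) * ((∑ i ∈ Finset.range m, k ^ i) * ∑' i : ℕ, (k ^ m) ^ i) = 1 := by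
    rw [← mul_assoc, mul_neg_geom_sum]
    exact mul_neg_geom_series _ hlt
  refine ⟨_, hP.mul_mem _ hS _ hG, hleft, ?_⟩
  rw [left_inv_eq_right_inv hleft hright]
  exact hright

theorem IsCone.interior_add_mem (hP : IsCone P) {a b : A} (ha : a ∈ interior P) (hb : b ∈ P) :
    a + b ∈ interior P := by
  have hsub : (fun x => x + b) '' interior P ⊆ P := by
    rintro _ ⟨x, hx, rfl⟩
    exact hP.add_mem _ (interior_subset hx) _ hb
  exact interior_maximal hsub ((isOpenMap_add_right b) _ isOpen_interior) ⟨a, ha, rfl⟩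

theorem IsCone.smul_mem_interior (hP : IsCone P) {a : A} (ha : a ∈ interior P) {t : ℝ}
    (ht : 0 < t) : t • a ∈ interior P := by
  have hsub : (fun x => t • x) '' interior P ⊆ P := by
    rintro _ ⟨x, hx, rfl⟩
    exact hP.smul_mem _ ht.le _ (interior_subset hx)
  exact interior_maximal hsub ((isOpenMap_smul₀ ht.ne') _ isOpen_interior) ⟨a, ha, rfl⟩

theorem CSeq.of_tendsto_zero {u : ℕ → A} (hu : Tendsto u atTop (𝓝 0)) : CSeq P u := by
  intro c hc
  have hlim : Tendsto (fun n => c - u n) atTop (𝓝 c) := by simpa using hu.const_sub c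
  exact eventually_atTop.1 (hlim.eventually (isOpen_interior.mem_nhds hc))

theorem CSeq.mono (hP : IsCone P) {u v : ℕ → A} (hv : CSeq P v) (h : ∀ n, v n - u n ∈ P) :
    CSeq P u := by
  intro c hc
  obtain ⟨N, hN⟩ := hv c hc
  refine ⟨N, fun n hn => ?_⟩
  simpa using hP.interior_add_mem (hN n hn) (h n)

theorem CSeq.add (hP : IsCone P) {u v : ℕ → A} (hu : CSeq P u) (hv : CSeq P v) :
    CSeq P fun n => u n + v n := by
  intro c hc
  have hc2 : (2⁻¹ : ℝ) • c ∈ interior P := hP.smul_mem_interior hc (by norm_num)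
  obtain ⟨N, hN⟩ := hu _ hc2
  obtain ⟨M, hM⟩ := hv _ hc2
  refine ⟨max N M, fun n hn => ?_⟩
  have hmem := hP.interior_add_mem (hN n (le_of_max_le_left hn))
    (interior_subset (hM n (le_of_max_le_right hn)))
  convert hmem using 1
  module

theorem CSeq.const_mul (hP : IsCone P) {u : ℕ → A} (hu : CSeq P u) {r : A} (hr : r ∈ P) :
    CSeq P fun n => r * u n := by
  intro c hc
  have hlim : Tendsto (fun t : ℝ => c - r * (t • c)) (𝓝[>] 0) (𝓝 c) := by
    have hcont : Continuous fun t : ℝ => c - r * (t • c) := by fun_prop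
    simpa using (hcont.tendsto 0).mono_left nhdsWithin_le_nhds
  obtain ⟨t, ht, htpos⟩ :=
    ((hlim.eventually (isOpen_interior.mem_nhds hc)).and self_mem_nhdsWithin).exists
  obtain ⟨N, hN⟩ := hu _ (hP.smul_mem_interior hc htpos)
  refine ⟨N, fun n hn => ?_⟩
  have hmem := hP.interior_add_mem ht (hP.mul_mem _ hr _ (interior_subset (hN n hn)))
  convert hmem using 1
  noncomm_ring

theorem CSeq.comp_succ {u : ℕ → A} (hu : CSeq P u) : CSeq P fun n => u (n + 1) := by
  intro c hc
  obtain ⟨N, hN⟩ := hu c hc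
  exact ⟨N, fun n hn => hN (n + 1) (by omega)⟩

theorem IsCone.eq_zero_of_cSeq_const (hP : IsCone P) (hsolid : (interior P).Nonempty) {a : A}
    (ha : a ∈ P) (h : CSeq P fun _ => a) : a = 0 := by
  obtain ⟨c, hc⟩ := hsolid
  refine hP.antisymm a ha ?_
  have hlim : Tendsto (fun t : ℝ => t • c - a) (𝓝[>] 0) (𝓝 (-a)) := by
    have hcont : Continuous fun t : ℝ => t • c - a := by fun_prop
    simpa using (hcont.tendsto 0).mono_left nhdsWithin_le_nhds
  refine hP.closed.mem_of_tendsto hlim ?_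
  filter_upwards [self_mem_nhdsWithin] with t ht
  obtain ⟨N, hN⟩ := h _ (hP.smul_mem_interior hc ht)
  exact interior_subset (hN N le_rfl)

/-- If `a ⪯ k a + b` and `r ∈ P` is a left inverse of `1 - k`, then `a ⪯ r b`. -/
theorem IsCone.mul_sub_mem_of_le (hP : IsCone P) {k r a b : A} (hr : r ∈ P)
    (hinv : r * (1 - k) = 1) (h : k * a + b - a ∈ P) : r * b - a ∈ P := by
  have hmem := hP.mul_mem _ hr _ h
  have heq : r * (k * a + b - a) = r * b - r * (1 - k) * a := by noncomm_ring
  rwa [heq, hinv, one_mul] at hmem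

end Cone

section Contraction

variable {A : Type*} [NormedRing A] [NormedAlgebra ℝ A] {P : Set A} {X : Type*} {d : X → X → A}
  {S : X → X} {k : A}

theorem IsConeMetric.self_eq_zero (hd : IsConeMetric P d) (x : X) : d x x = 0 :=
  (hd.eq_zero_iff x x).2 rfl

theorem IsCone.iterate_contraction (hP : IsCone P) (hk : k ∈ P)
    (hS : ∀ a b, k * d a b - d (S a) (S b) ∈ P) (n : ℕ) (a b : X) :
    k ^ n * d a b - d (S^[n] a) (S^[n] b) ∈ P := by
  induction n with
  | zero => simpa using hP.zero_mem
  | succ n ih =>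
    rw [Function.iterate_succ_apply', Function.iterate_succ_apply']
    have hmem := hP.add_mem _ (hP.mul_mem _ hk _ ih) _ (hS (S^[n] a) (S^[n] b))
    convert hmem using 1
    rw [pow_succ']
    noncomm_ring

theorem IsConeMetric.dist_iterate_le (hP : IsCone P) (hd : IsConeMetric P d) (hk : k ∈ P)
    (hS : ∀ a b, k * d a b - d (S a) (S b) ∈ P) {r : A} (hr : r ∈ P) (hinv : (1 - k) * r = 1)
    (n : ℕ) (x : X) : r * d x (S x) - d x (S^[n] x) ∈ P := by
  induction n with
  | zero => simpa [hd.self_eq_zero] using hP.mul_mem _ hr _ (hd.mem_cone x (S x))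
  | succ n ih =>
    rw [Function.iterate_succ_apply']
    have hmem := hP.add_mem _ (hP.add_mem _ (hP.mul_mem _ hk _ ih) _ (hS x (S^[n] x))) _
      (hd.triangle x (S x) (S (S^[n] x)))
    convert hmem using 1
    have hkr : r = 1 + k * r := by rw [← hinv]; noncomm_ring
    nth_rewrite 1 [hkr]
    noncomm_ring

/-- Banach's fixed point theorem in a complete cone metric space over a Banach algebra. -/
theorem IsConeMetric.exists_unique_fixedPoint [CompleteSpace A] [Nonempty X] (hP : IsCone P)
    (hsolid : (interior P).Nonempty) (hd : IsConeMetric P d) (hcompl : ConeComplete P d)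
    (hk : k ∈ P) (hρ : specRad k < 1) (hS : ∀ a b, k * d a b - d (S a) (S b) ∈ P) :
    ∃ x, S x = x ∧ ∀ y, S y = y → y = x := by
  obtain ⟨r, hr, hinv, hinv'⟩ := hP.exists_inverse_one_sub hk hρ
  obtain ⟨x₀⟩ := ‹Nonempty X›
  have hbound (m n : ℕ) : k ^ m * (r * d x₀ (S x₀)) - d (S^[m] x₀) (S^[m + n] x₀) ∈ P := by
    have hmem := hP.add_mem _ (hP.mul_mem _ (hP.pow_mem hk m) _
      (hd.dist_iterate_le hP hk hS hr hinv' n x₀)) _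
      (hP.iterate_contraction hk hS m x₀ (S^[n] x₀))
    rw [← Function.iterate_add_apply] at hmem
    convert hmem using 1
    noncomm_ring
  have hsmall : CSeq P fun m => k ^ m * (r * d x₀ (S x₀)) :=
    CSeq.of_tendsto_zero (by
      simpa using (tendsto_pow_zero_of_specRad_lt_one hρ).mul_const (r * d x₀ (S x₀)))
  obtain ⟨x, hx⟩ := hcompl (fun n => S^[n] x₀) fun c hc => by
    obtain ⟨N, hN⟩ := hsmall c hc
    have hle : ∀ m ≥ N, ∀ n ≥ m, c - d (S^[m] x₀) (S^[n] x₀) ∈ interior P := by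
      intro m hm n hn
      obtain ⟨j, rfl⟩ := Nat.exists_eq_add_of_le hn
      simpa using hP.interior_add_mem (hN m hm) (hbound m j)
    refine ⟨N, fun m hm n hn => ?_⟩
    rcases le_total m n with h | h
    · exact hle m hm n h
    · rw [hd.symm]
      exact hle n hn m h
  have hfix : S x = x := by
    rw [← hd.eq_zero_iff]
    refine hP.eq_zero_of_cSeq_const hsolid (hd.mem_cone _ _)
      (((hx.const_mul hP hk).add hP hx.comp_succ).mono hP fun n => ?_)
    have hmem := hP.add_mem _ (hS (S^[n] x₀) x) _ (hd.triangle (S x) (S^[n + 1] x₀) x)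
    rw [hd.symm (S x) (S^[n + 1] x₀), Function.iterate_succ_apply'] at hmem
    convert hmem using 1
    simp only [Function.iterate_succ_apply']
    abel
  refine ⟨x, hfix, fun y hy => ?_⟩
  have hle := hS y x
  rw [hy, hfix] at hle
  have hneg := hP.mul_sub_mem_of_le (b := 0) hr hinv (by simpa using hle)
  exact (hd.eq_zero_iff y x).1 (hP.antisymm _ (hd.mem_cone y x) (by simpa using hneg))

end Contraction

/-- Pointwise convergence of `α`-contractions `T n` to an `α₀`-contraction `T∞` on a complete
cone metric space over a Banach algebra: each `T n` has a unique fixed point `xs n`, `T∞` has a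
unique fixed point `xl`, and `(d (xs n) xl)` is a c-sequence. -/
theorem fixedPoints_cSeq_of_pointwise_convergence {A : Type*} [NormedRing A] [NormedAlgebra ℝ A]
    [CompleteSpace A] {X : Type*} [Nonempty X]
    (P : Set A) (hP : IsCone P) (hsolid : (interior P).Nonempty)
    (d : X → X → A) (hd : IsConeMetric P d) (hcompl : ConeComplete P d)
    (T : ℕ → X → X) (Tinf : X → X)
    (α : A) (hα : α ∈ P) (hρ : specRad α < 1)
    (hcontr : ∀ n, ∀ a b : X, α * d a b - d (T n a) (T n b) ∈ P)
    (α₀ : A) (hα₀ : α₀ ∈ P) (hρ₀ : specRad α₀ < 1)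
    (hcontr₀ : ∀ a b : X, α₀ * d a b - d (Tinf a) (Tinf b) ∈ P)
    (hpt : ∀ a : X, CSeq P fun n => d (T n a) (Tinf a)) :
    ∃ (xs : ℕ → X) (xl : X),
      (∀ n, T n (xs n) = xs n ∧ ∀ y : X, T n y = y → y = xs n) ∧
      (Tinf xl = xl ∧ ∀ y : X, Tinf y = y → y = xl) ∧
      CSeq P fun n => d (xs n) xl := by
  choose xs hxs using fun n => hd.exists_unique_fixedPoint hP hsolid hcompl hα hρ (hcontr n)
  obtain ⟨xl, hxl⟩ := hd.exists_unique_fixedPoint hP hsolid hcompl hα₀ hρ₀ hcontr₀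
  obtain ⟨r, hr, hinv, -⟩ := hP.exists_inverse_one_sub hα hρ
  refine ⟨xs, xl, hxs, hxl, ((hpt xl).const_mul hP hr).mono hP fun n => ?_⟩
  refine hP.mul_sub_mem_of_le hr hinv ?_
  have hmem := hP.add_mem _ (hcontr n (xs n) xl) _ (hd.triangle (xs n) (T n xl) xl)
  rw [(hxs n).1] at hmem
  rw [hxl.1]
  convert hmem using 1
  abel
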